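/- For every real number α < 0 there exists a unique β0 in the open interval (π/2, π) such that tan β0 = β0/α (equivalently, α·sin β0 = β0·cos β0). -/

import Mathlib

theorem aux_lt (α : ℝ) (hα : α < 0) (x y : ℝ) (hx : Real.pi / 2 < x) (hy : y < Real.pi)
    (hxy : x < y) (h1 : α * Real.sin x = x * Real.cos x)
    (h2 : α * Real.sin y = y * Real.cos y) : False := by
  have hp := Real.pi_pos
  have hc : Real.cos y < Real.cos x :=
    Real.cos_lt_cos_of_nonneg_of_le_pi (by linarith) hy.le hxy
  have hc0 : Real.cos x < 0 := Real.cos_neg_of_pi_div_two_lt_of_lt hx (by linarith)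
  have hs : Real.sin y < Real.sin x := by
    rw [← Real.sin_pi_sub y, ← Real.sin_pi_sub x]
    exact Real.sin_lt_sin_of_lt_of_le_pi_div_two (by linarith) (by linarith) (by linarith)
  have h3 : α * Real.sin x < α * Real.sin y := mul_lt_mul_of_neg_left hs hα
  have h4 : y * Real.cos y < y * Real.cos x := mul_lt_mul_of_pos_left hc (by linarith)
  have h5 : y * Real.cos x < x * Real.cos x := mul_lt_mul_of_neg_right hxy hc0
  linarith

/-- For every real `α < 0` there exists a unique `β0` in the open interval `(π/2, π)`
such that `tan β0 = β0 / α`, equivalently `α · sin β0 = β0 · cos β0`. -/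
theorem stmt0 (α : ℝ) (hα : α < 0) :
    ∃! β0 : ℝ, β0 ∈ Set.Ioo (Real.pi / 2) Real.pi ∧
      α * Real.sin β0 = β0 * Real.cos β0 := by
  have hp := Real.pi_pos
  have hcont : ContinuousOn (fun x : ℝ => x * Real.cos x - α * Real.sin x)
      (Set.Icc (Real.pi / 2) Real.pi) := by fun_prop
  have hz : (0 : ℝ) ∈ Set.Ioo (Real.pi * Real.cos Real.pi - α * Real.sin Real.pi)
      (Real.pi / 2 * Real.cos (Real.pi / 2) - α * Real.sin (Real.pi / 2)) := by
    constructor <;> simp <;> linarith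
  obtain ⟨b, hb, hb0⟩ := intermediate_value_Ioo' (by linarith) hcont hz
  have hb1 : α * Real.sin b = b * Real.cos b := by
    have : b * Real.cos b - α * Real.sin b = 0 := hb0
    linarith
  refine ⟨b, ⟨hb, hb1⟩, ?_⟩
  rintro y ⟨hy, hy1⟩
  rcases lt_trichotomy y b with h | h | h
  · exact (aux_lt α hα y b hy.1 hb.2 h hy1 hb1).elim
  · exact h
  · exact (aux_lt α hα b y hb.1 hy.2 h hb1 hy1).elim
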